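/- Let $\gamma > 0$ and $\beta > 0$. The function $y$ defined on $(0,\infty)$ by $$y(x) = e^{-x} \int_0^\infty e^{-2xt}\, t^{\beta/2 - 1} (1+t)^{-(\gamma + \beta/2 + 1)}\, dt$$ is well defined, smooth, bounded and not identically zero on $(0,\infty)$, and it solves the ordinary differential equation $x g''(x) - \gamma g'(x) - (x + \gamma + \beta) g(x) = 0$ on $(0,\infty)$. -/

import Mathlib

noncomputable section

/-- The integrand `e^{-2xt} t^{β/2-1} (1+t)^{-(γ+β/2+1)}`, used for `t > 0`. -/
def yIntegrand (γ β x t : ℝ) : ℝ :=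
  Real.exp (-2 * x * t) * t ^ (β / 2 - 1) * (1 + t) ^ (-(γ + β / 2 + 1))

/-- `y(x) = e^{-x} ∫_0^∞ e^{-2xt} t^{β/2-1} (1+t)^{-(γ+β/2+1)} dt`, used for `x > 0`. -/
def ySol (γ β : ℝ) (x : ℝ) : ℝ :=
  Real.exp (-x) * ∫ t in Set.Ioi (0 : ℝ), yIntegrand γ β x t

end

open MeasureTheory Set Filter Topology

noncomputable section

/-- The integrand `e^{-2xt} t^s (1+t)^{-c}` of the Laplace-type representation of Kummer's
second function. -/
def tricomiIntegrand (s c x t : ℝ) : ℝ :=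
  Real.exp (-2 * x * t) * t ^ s * (1 + t) ^ (-c)

/-- `∫_0^∞ e^{-2xt} t^s (1+t)^{-c} dt`. -/
def tricomiIntegral (s c x : ℝ) : ℝ :=
  ∫ t in Ioi (0 : ℝ), tricomiIntegrand s c x t

end

lemma measurable_tricomiIntegrand (s c x : ℝ) : Measurable (tricomiIntegrand s c x) := by
  unfold tricomiIntegrand
  fun_prop

lemma tricomiIntegrand_pos (s c x : ℝ) {t : ℝ} (ht : 0 < t) : 0 < tricomiIntegrand s c x t := by
  unfold tricomiIntegrand
  positivity

lemma tricomiIntegrand_le_of_le (s c : ℝ) {x x' t : ℝ} (hx : x ≤ x') (ht : 0 < t) :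
    tricomiIntegrand s c x' t ≤ tricomiIntegrand s c x t := by
  unfold tricomiIntegrand
  gcongr ?_ * _ * _
  exact Real.exp_le_exp.2 (by nlinarith)

lemma tricomiIntegrand_le_rpow_mul_exp (s : ℝ) {c : ℝ} (hc : 0 ≤ c) (x : ℝ) {t : ℝ} (ht : 0 < t) :
    tricomiIntegrand s c x t ≤ t ^ s * Real.exp (-(2 * x) * t) := by
  have h1 : (1 + t) ^ (-c) ≤ 1 :=
    Real.rpow_le_one_of_one_le_of_nonpos (by linarith) (by linarith)
  calc tricomiIntegrand s c x t
      ≤ Real.exp (-2 * x * t) * t ^ s * 1 := by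
        unfold tricomiIntegrand
        gcongr
    _ = t ^ s * Real.exp (-(2 * x) * t) := by
        rw [mul_one, mul_comm, show -2 * x * t = -(2 * x) * t by ring]

lemma tricomiIntegrand_add_one (s c x : ℝ) {t : ℝ} (ht : 0 < t) :
    tricomiIntegrand (s + 1) c x t = t * tricomiIntegrand s c x t := by
  unfold tricomiIntegrand
  rw [Real.rpow_add_one ht.ne']
  ring

lemma integrableOn_tricomiIntegrand {s c x : ℝ} (hs : -1 < s) (hc : 0 ≤ c) (hx : 0 < x) :
    IntegrableOn (tricomiIntegrand s c x) (Ioi 0) := by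
  have h : IntegrableOn (fun t : ℝ => t ^ s * Real.exp (-(2 * x) * t)) (Ioi 0) := by
    simpa using integrableOn_rpow_mul_exp_neg_mul_rpow hs one_pos (show 0 < 2 * x by positivity)
  refine Integrable.mono' h (measurable_tricomiIntegrand s c x).aestronglyMeasurable ?_
  filter_upwards [ae_restrict_mem measurableSet_Ioi] with t ht
  rw [Real.norm_of_nonneg (tricomiIntegrand_pos s c x ht).le]
  exact tricomiIntegrand_le_rpow_mul_exp s hc x ht

/-- At `x = 0` the integrand is still integrable when it decays fast enough. -/
lemma integrableOn_tricomiIntegrand_zero {s c : ℝ} (hs : -1 < s) (hc : 0 ≤ c)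
    (hsc : s - c < -1) : IntegrableOn (tricomiIntegrand s c 0) (Ioi 0) := by
  rw [← Ioc_union_Ioi_eq_Ioi (zero_le_one' ℝ)]
  refine IntegrableOn.union ?_ ?_
  · have h : IntegrableOn (fun t : ℝ => t ^ s) (Ioc 0 1) :=
      (intervalIntegrable_iff_integrableOn_Ioc_of_le zero_le_one).1
        (intervalIntegral.intervalIntegrable_rpow' hs)
    refine Integrable.mono' h (measurable_tricomiIntegrand s c 0).aestronglyMeasurable ?_
    filter_upwards [ae_restrict_mem measurableSet_Ioc] with t ht
    rw [Real.norm_of_nonneg (tricomiIntegrand_pos s c 0 ht.1).le]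
    simpa using tricomiIntegrand_le_rpow_mul_exp s hc 0 ht.1
  · refine Integrable.mono' (integrableOn_Ioi_rpow_of_lt hsc one_pos)
      (measurable_tricomiIntegrand s c 0).aestronglyMeasurable ?_
    filter_upwards [ae_restrict_mem measurableSet_Ioi] with t ht
    have ht0 : (0 : ℝ) < t := zero_lt_one.trans ht
    rw [Real.norm_of_nonneg (tricomiIntegrand_pos s c 0 ht0).le, sub_eq_add_neg,
      Real.rpow_add ht0]
    have h1 : (1 + t) ^ (-c) ≤ t ^ (-c) :=
      Real.rpow_le_rpow_of_nonpos ht0 (by linarith) (by linarith)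
    have h2 : 0 ≤ t ^ s := by positivity
    simpa [tricomiIntegrand] using mul_le_mul_of_nonneg_left h1 h2

lemma tricomiIntegral_pos {s c x : ℝ} (hs : -1 < s) (hc : 0 ≤ c) (hx : 0 < x) :
    0 < tricomiIntegral s c x := by
  unfold tricomiIntegral
  rw [setIntegral_pos_iff_support_of_nonneg_ae _ (integrableOn_tricomiIntegrand hs hc hx)]
  · have h : Ioi 0 ⊆ Function.support (tricomiIntegrand s c x) :=
      fun t ht => (tricomiIntegrand_pos s c x ht).ne'
    simp [inter_eq_right.2 h]
  · filter_upwards [ae_restrict_mem measurableSet_Ioi] with t ht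
    exact (tricomiIntegrand_pos s c x ht).le

lemma tricomiIntegral_le_zero {s c x : ℝ} (hs : -1 < s) (hc : 0 ≤ c) (hsc : s - c < -1)
    (hx : 0 < x) : tricomiIntegral s c x ≤ tricomiIntegral s c 0 :=
  setIntegral_mono_on (integrableOn_tricomiIntegrand hs hc hx)
    (integrableOn_tricomiIntegrand_zero hs hc hsc) measurableSet_Ioi
    fun _ ht => tricomiIntegrand_le_of_le s c hx.le ht

lemma hasDerivAt_tricomiIntegral {s c x : ℝ} (hs : -1 < s) (hc : 0 ≤ c) (hx : 0 < x) :
    HasDerivAt (tricomiIntegral s c) (-2 * tricomiIntegral (s + 1) c x) x := by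
  have hint := integrableOn_tricomiIntegrand (s := s + 1) (by linarith) hc (half_pos hx)
  have key := hasDerivAt_integral_of_dominated_loc_of_deriv_le
    (μ := volume.restrict (Ioi (0 : ℝ))) (F := tricomiIntegrand s c)
    (F' := fun x t => -2 * t * tricomiIntegrand s c x t) (x₀ := x)
    (bound := fun t => 2 * tricomiIntegrand (s + 1) c (x / 2) t)
    (Ioi_mem_nhds (half_lt_self hx))
    (Eventually.of_forall fun x => (measurable_tricomiIntegrand s c x).aestronglyMeasurable)
    (integrableOn_tricomiIntegrand hs hc hx)
    ((measurable_id.const_mul (-2)).mul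
      (measurable_tricomiIntegrand s c x)).aestronglyMeasurable
    ?_ (hint.const_mul 2) ?_
  · refine key.2.congr_deriv ?_
    rw [tricomiIntegral, ← integral_const_mul]
    refine setIntegral_congr_fun measurableSet_Ioi fun t ht => ?_
    simp only [tricomiIntegrand_add_one s c x ht]
    ring
  · filter_upwards [ae_restrict_mem measurableSet_Ioi] with t ht x' hx'
    have ht0 : (0 : ℝ) < t := ht
    rw [mul_assoc, ← tricomiIntegrand_add_one s c x' ht, norm_mul,
      Real.norm_of_nonneg (tricomiIntegrand_pos _ c x' ht).le, norm_neg, Real.norm_two]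
    exact mul_le_mul_of_nonneg_left (tricomiIntegrand_le_of_le _ c (le_of_lt hx') ht) zero_le_two
  · refine Eventually.of_forall fun t x' _ => ?_
    have h : HasDerivAt (fun x : ℝ => -2 * x * t) (-2 * t) x' := by
      simpa using ((hasDerivAt_id x').const_mul (-2)).mul_const t
    refine ((h.exp.mul_const (t ^ s)).mul_const ((1 + t) ^ (-c))).congr_deriv ?_
    unfold tricomiIntegrand
    ring

lemma contDiffOn_tricomiIntegral {s c : ℝ} (hs : -1 < s) (hc : 0 ≤ c) :
    ContDiffOn ℝ (⊤ : ℕ∞) (tricomiIntegral s c) (Ioi 0) := by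
  refine contDiffOn_infty.2 fun n => ?_
  induction n generalizing s with
  | zero =>
    exact contDiffOn_zero.2 fun x hx =>
      (hasDerivAt_tricomiIntegral hs hc hx).continuousAt.continuousWithinAt
  | succ n ih =>
    rw [Nat.cast_add, Nat.cast_one, contDiffOn_succ_iff_deriv_of_isOpen isOpen_Ioi]
    refine ⟨fun x hx =>
      (hasDerivAt_tricomiIntegral hs hc hx).differentiableAt.differentiableWithinAt,
      by simp, ?_⟩
    exact (contDiffOn_const.mul (ih (s := s + 1) (by linarith))).congr fun x hx =>
      (hasDerivAt_tricomiIntegral hs hc hx).deriv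

/-- The contiguous relation expressing Kummer's equation, obtained by integrating the derivative
of `e^{-2xt} t^a (1+t)^{-(γ+a)}` over `(0,∞)`. -/
lemma tricomiIntegral_contiguous {γ a x : ℝ} (hγ : 0 < γ) (ha : 0 < a) (hx : 0 < x) :
    4 * x * tricomiIntegral (a - 1 + 1 + 1) (γ + a + 1) x
      + (4 * x + 2 * γ) * tricomiIntegral (a - 1 + 1) (γ + a + 1) x
      - 2 * a * tricomiIntegral (a - 1) (γ + a + 1) x = 0 := by
  have hc : 0 ≤ γ + a + 1 := by positivity
  have i0 := integrableOn_tricomiIntegrand (s := a - 1) (by linarith) hc hx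
  have i1 := integrableOn_tricomiIntegrand (s := a - 1 + 1) (by linarith) hc hx
  have i2 := integrableOn_tricomiIntegrand (s := a - 1 + 1 + 1) (by linarith) hc hx
  have i21 : IntegrableOn (fun t => 4 * x * tricomiIntegrand (a - 1 + 1 + 1) (γ + a + 1) x t
      + (4 * x + 2 * γ) * tricomiIntegrand (a - 1 + 1) (γ + a + 1) x t) (Ioi 0) :=
    (i2.const_mul (4 * x)).add (i1.const_mul (4 * x + 2 * γ))
  have hcont : Continuous fun t : ℝ => Real.exp (-2 * x * t) * t ^ a :=
    (by fun_prop : Continuous fun t : ℝ => Real.exp (-2 * x * t)).mul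
      (Real.continuous_rpow_const ha.le)
  have key := integral_Ioi_of_hasDerivAt_of_tendsto (a := 0) (m := 0)
    (f := fun t => -2 * tricomiIntegrand a (γ + a) x t)
    (f' := fun t => (4 * x * tricomiIntegrand (a - 1 + 1 + 1) (γ + a + 1) x t
      + (4 * x + 2 * γ) * tricomiIntegrand (a - 1 + 1) (γ + a + 1) x t)
      - 2 * a * tricomiIntegrand (a - 1) (γ + a + 1) x t) ?_ ?_
      (i21.sub (i0.const_mul (2 * a))) ?_
  · rw [integral_sub i21 (i0.const_mul (2 * a)),
      integral_add (i2.const_mul (4 * x)) (i1.const_mul (4 * x + 2 * γ)),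
      integral_const_mul, integral_const_mul, integral_const_mul] at key
    simpa [tricomiIntegral, tricomiIntegrand, Real.zero_rpow ha.ne'] using key
  · refine ContinuousAt.continuousWithinAt ?_
    refine continuousAt_const.mul (hcont.continuousAt.mul ?_)
    exact (continuousAt_const.add continuousAt_id).rpow_const (Or.inl (by simp))
  · intro t ht
    have ht0 : (0 : ℝ) < t := ht
    have h1t : 0 < 1 + t := by linarith
    have he : HasDerivAt (fun t : ℝ => Real.exp (-2 * x * t))
        (Real.exp (-2 * x * t) * (-2 * x)) t := by
      simpa using ((hasDerivAt_id t).const_mul (-2 * x)).exp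
    have hp := Real.hasDerivAt_rpow_const (x := t) (p := a) (Or.inl ht0.ne')
    have hq : HasDerivAt (fun t : ℝ => (1 + t) ^ (-(γ + a)))
        (-(γ + a) * (1 + t) ^ (-(γ + a) - 1)) t := by
      simpa using ((hasDerivAt_id t).const_add 1).rpow_const (p := -(γ + a)) (Or.inl h1t.ne')
    refine (((he.mul hp).mul hq).const_mul (-2)).congr_deriv ?_
    have e1 : t ^ a = t ^ (a - 1) * t := by
      rw [← Real.rpow_add_one ht0.ne', sub_add_cancel]
    have e2 : (1 + t) ^ (-(γ + a)) = (1 + t) ^ (-(γ + a) - 1) * (1 + t) := by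
      rw [← Real.rpow_add_one h1t.ne', sub_add_cancel]
    rw [tricomiIntegrand_add_one _ _ _ ht0, tricomiIntegrand_add_one _ _ _ ht0, e2, Pi.mul_apply,
      e1, tricomiIntegrand, neg_add' (γ + a) 1]
    ring
  · have h := tendsto_rpow_mul_exp_neg_mul_atTop_nhds_zero a (2 * x) (by positivity)
    have h0 : Tendsto (tricomiIntegrand a (γ + a) x) atTop (𝓝 0) := by
      refine tendsto_of_tendsto_of_tendsto_of_le_of_le' tendsto_const_nhds h ?_ ?_
      · filter_upwards [eventually_gt_atTop 0] with t ht
        exact (tricomiIntegrand_pos _ _ x ht).le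
      · filter_upwards [eventually_gt_atTop 0] with t ht
        exact tricomiIntegrand_le_rpow_mul_exp a (by positivity) x ht
    simpa using h0.const_mul (-2)

lemma hasDerivAt_exp_neg_mul {f : ℝ → ℝ} {f' x : ℝ} (hf : HasDerivAt f f' x) :
    HasDerivAt (fun x => Real.exp (-x) * f x) (Real.exp (-x) * (f' - f x)) x := by
  refine ((hasDerivAt_neg x).exp.mul hf).congr_deriv ?_
  ring

lemma ySol_eq (γ β : ℝ) :
    ySol γ β = fun x => Real.exp (-x) * tricomiIntegral (β / 2 - 1) (γ + β / 2 + 1) x :=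
  rfl

/-- `y` is well defined (the integrand is integrable), smooth, bounded and not
identically zero on `(0,∞)`, and solves `x g'' - γ g' - (x + γ + β) g = 0` there. -/
theorem stmt9 (γ β : ℝ) (hγ : 0 < γ) (hβ : 0 < β) :
    (∀ x : ℝ, 0 < x → MeasureTheory.IntegrableOn (yIntegrand γ β x) (Set.Ioi 0)) ∧
    ContDiffOn ℝ (⊤ : ℕ∞) (ySol γ β) (Set.Ioi 0) ∧
    (∃ C : ℝ, ∀ x : ℝ, 0 < x → |ySol γ β x| ≤ C) ∧
    (∃ x : ℝ, 0 < x ∧ ySol γ β x ≠ 0) ∧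
    (∀ x : ℝ, 0 < x →
      x * deriv (deriv (ySol γ β)) x - γ * deriv (ySol γ β) x
        - (x + γ + β) * ySol γ β x = 0) := by
  have hs : -1 < β / 2 - 1 := by linarith
  have hc : 0 ≤ γ + β / 2 + 1 := by positivity
  refine ⟨fun x hx => integrableOn_tricomiIntegrand hs hc hx, ?_,
    ⟨tricomiIntegral (β / 2 - 1) (γ + β / 2 + 1) 0, fun x hx => ?_⟩,
    ⟨1, one_pos, (mul_pos (Real.exp_pos _) (tricomiIntegral_pos hs hc one_pos)).ne'⟩,
    fun x hx => ?_⟩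
  · exact (Real.contDiff_exp.comp contDiff_neg).contDiffOn.mul (contDiffOn_tricomiIntegral hs hc)
  · have hpos := tricomiIntegral_pos hs hc hx
    rw [ySol_eq, abs_of_pos (mul_pos (Real.exp_pos _) hpos)]
    exact (mul_le_of_le_one_left hpos.le (Real.exp_le_one_iff.2 (by linarith))).trans
      (tricomiIntegral_le_zero hs hc (by linarith) hx)
  · have d0 : ∀ z : ℝ, 0 < z → HasDerivAt (tricomiIntegral (β / 2 - 1) (γ + β / 2 + 1)) _ z :=
      fun z hz => hasDerivAt_tricomiIntegral hs hc hz
    have d1 := hasDerivAt_tricomiIntegral (s := β / 2 - 1 + 1) (by linarith) hc hx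
    have hd : ∀ z : ℝ, 0 < z → deriv (ySol γ β) z = _ :=
      fun z hz => (hasDerivAt_exp_neg_mul (d0 z hz)).deriv
    have hdd : deriv (deriv (ySol γ β)) x = _ :=
      (EventuallyEq.deriv_eq (by filter_upwards [Ioi_mem_nhds hx] with z hz using hd z hz)).trans
        (hasDerivAt_exp_neg_mul ((d1.const_mul (-2)).sub (d0 x hx))).deriv
    rw [hdd, hd x hx, ySol_eq, Pi.sub_apply]
    linear_combination Real.exp (-x) *
      tricomiIntegral_contiguous hγ (half_pos hβ) hx
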